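/- Every relaxed Mann-Kleene scheme is exact: if (α_n), (β_n) are sequences in [0,1) with lim β_n = 0, Σ_n β_n = ∞ and (α_n) converging to a limit α < 1, then for every d ∈ ℕ, every closed convex set X ⊆ ℝ^d of vectors with non-negative entries containing 0, every monotone non-expansive f : X → X with at least one fixpoint, and every x_0 ∈ X, the dampened Mann iteration with the constant function sequence f_n = f converges to the least fixpoint μf of f. -/

import Mathlib

open Filter Set Topology

/-- The dampened Mann iteration:
`x₀ = x0`, `x_{n+1} = (1 - β n) • (α n • x n + (1 - α n) • f n (x n))`. -/
noncomputable def mannSeq {E : Type*} [AddCommGroup E] [Module ℝ E]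
    (α β : ℕ → ℝ) (f : ℕ → E → E) (x0 : E) : ℕ → E
  | 0 => x0
  | n + 1 => (1 - β n) • (α n • mannSeq α β f x0 n + (1 - α n) • f n (mannSeq α β f x0 n))

theorem mannSeq_mem {E : Type*} [AddCommGroup E] [Module ℝ E] {α β : ℕ → ℝ}
    (hα : ∀ n, α n ∈ Ico (0 : ℝ) 1) (hβ : ∀ n, β n ∈ Ico (0 : ℝ) 1) {X : Set E}
    (hXc : Convex ℝ X) (h0 : (0 : E) ∈ X) {f : E → E} (hmap : MapsTo f X X) {x : E}
    (hx : x ∈ X) (n : ℕ) : mannSeq α β (fun _ => f) x n ∈ X := by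
  induction n with
  | zero => exact hx
  | succ n ih =>
    refine hXc.smul_mem_of_zero_mem h0 (hXc ih (hmap ih) (hα n).1 ?_ (by ring)) ⟨?_, ?_⟩ <;>
      linarith [(hα n).2, (hβ n).1, (hβ n).2]

theorem mannSeq_add {E : Type*} [AddCommGroup E] [Module ℝ E] (α β : ℕ → ℝ) (f : E → E)
    (x : E) (N n : ℕ) :
    mannSeq α β (fun _ => f) x (n + N) =
      mannSeq (fun k => α (k + N)) (fun k => β (k + N)) (fun _ => f)
        (mannSeq α β (fun _ => f) x N) n := by
  induction n with
  | zero => simp [mannSeq]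
  | succ n ih => rw [Nat.add_right_comm, mannSeq, mannSeq, ih]

theorem tendsto_prod_one_sub_zero {β : ℕ → ℝ} (hβ : ∀ n, β n ∈ Ico (0 : ℝ) 1)
    (hβdiv : ¬ Summable β) :
    Tendsto (fun n => ∏ k ∈ Finset.range n, (1 - β k)) atTop (𝓝 0) := by
  have hsum := (not_summable_iff_tendsto_nat_atTop_of_nonneg fun n => (hβ n).1).1 hβdiv
  refine squeeze_zero (fun n => Finset.prod_nonneg fun k _ => by linarith [(hβ k).2])
    (fun n => ?_) (Real.tendsto_exp_neg_atTop_nhds_zero.comp hsum)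
  rw [Function.comp_apply, ← Finset.sum_neg_distrib, Real.exp_sum]
  exact Finset.prod_le_prod (fun k _ => by linarith [(hβ k).2])
    fun k _ => by linarith [Real.add_one_le_exp (-β k)]

/-- Dampened Mann iterations of a non-expansive map from two starting points merge. -/
theorem dist_mannSeq_le {E : Type*} [NormedAddCommGroup E] [NormedSpace ℝ E] {α β : ℕ → ℝ}
    (hα : ∀ n, α n ∈ Ico (0 : ℝ) 1) (hβ : ∀ n, β n ∈ Ico (0 : ℝ) 1) {X : Set E}
    (hXc : Convex ℝ X) (h0 : (0 : E) ∈ X) {f : E → E} (hmap : MapsTo f X X)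
    (hne : LipschitzOnWith 1 f X) {x y : E} (hx : x ∈ X) (hy : y ∈ X) (n : ℕ) :
    dist (mannSeq α β (fun _ => f) x n) (mannSeq α β (fun _ => f) y n) ≤
      (∏ k ∈ Finset.range n, (1 - β k)) * dist x y := by
  induction n with
  | zero => simp [mannSeq]
  | succ n ih =>
    have hu := mannSeq_mem hα hβ hXc h0 hmap hx n
    have hv := mannSeq_mem hα hβ hXc h0 hmap hy n
    rw [mannSeq, mannSeq, Finset.prod_range_succ]
    set u := mannSeq α β (fun _ => f) x n
    set v := mannSeq α β (fun _ => f) y n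
    have hf : dist (f u) (f v) ≤ dist u v := by simpa using hne.dist_le_mul u hu v hv
    have hα0 := (hα n).1
    have hα1 : 0 ≤ 1 - α n := by linarith [(hα n).2]
    have hβ1 : 0 ≤ 1 - β n := by linarith [(hβ n).2]
    have key : dist (α n • u + (1 - α n) • f u) (α n • v + (1 - α n) • f v) ≤ dist u v := by
      refine (dist_add_add_le _ _ _ _).trans ?_
      rw [dist_smul₀, dist_smul₀, Real.norm_of_nonneg hα0, Real.norm_of_nonneg hα1]
      nlinarith
    rw [dist_smul₀, Real.norm_of_nonneg hβ1]
    calc (1 - β n) * _ ≤ (1 - β n) * ((∏ k ∈ Finset.range n, (1 - β k)) * dist x y) :=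
          mul_le_mul_of_nonneg_left (key.trans ih) hβ1
      _ = _ := by ring

theorem mannSeq_le_of_fixed {d : ℕ} {α β : ℕ → ℝ}
    (hα : ∀ n, α n ∈ Ico (0 : ℝ) 1) (hβ : ∀ n, β n ∈ Ico (0 : ℝ) 1) {X : Set (Fin d → ℝ)}
    (hXc : Convex ℝ X) (h0 : (0 : Fin d → ℝ) ∈ X) {f : (Fin d → ℝ) → Fin d → ℝ}
    (hmap : MapsTo f X X) (hmono : MonotoneOn f X) {μ : Fin d → ℝ} (hμX : μ ∈ X) (hμ0 : 0 ≤ μ)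
    (hμ : f μ = μ) {x : Fin d → ℝ} (hx : x ∈ X) (hxμ : x ≤ μ) (n : ℕ) :
    mannSeq α β (fun _ => f) x n ≤ μ := by
  induction n with
  | zero => exact hxμ
  | succ n ih =>
    have hu := mannSeq_mem hα hβ hXc h0 hmap hx n
    rw [mannSeq]
    set u := mannSeq α β (fun _ => f) x n
    have hf := hmono hu hμX ih
    rw [hμ] at hf
    intro i
    have h1 := ih i
    have h2 := hf i
    have h3 : 0 ≤ μ i := hμ0 i
    have hα0 := (hα n).1
    have hα1 : 0 ≤ 1 - α n := by linarith [(hα n).2]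
    have hβ1 : 0 ≤ 1 - β n := by linarith [(hβ n).2]
    simp only [Pi.smul_apply, Pi.add_apply, smul_eq_mul]
    have key : α n * u i + (1 - α n) * f u i ≤ μ i := by nlinarith
    nlinarith [mul_le_mul_of_nonneg_left key hβ1, mul_nonneg (hβ n).1 h3]

theorem le_mannSeq_of_le_step {d : ℕ} {α β : ℕ → ℝ}
    (hα : ∀ n, α n ∈ Ico (0 : ℝ) 1) (hβ : ∀ n, β n ∈ Ico (0 : ℝ) 1) {X : Set (Fin d → ℝ)}
    (hXc : Convex ℝ X) (h0 : (0 : Fin d → ℝ) ∈ X) {f : (Fin d → ℝ) → Fin d → ℝ}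
    (hmap : MapsTo f X X) (hmono : MonotoneOn f X) {y : Fin d → ℝ} (hy : y ∈ X)
    (hstep : ∀ n, y ≤ (1 - β n) • (α n • y + (1 - α n) • f y)) (n : ℕ) :
    y ≤ mannSeq α β (fun _ => f) y n := by
  induction n with
  | zero => exact le_rfl
  | succ n ih =>
    have hu := mannSeq_mem hα hβ hXc h0 hmap hy n
    rw [mannSeq]
    have hα0 := (hα n).1
    have hα1 : 0 ≤ 1 - α n := by linarith [(hα n).2]
    have hβ1 : 0 ≤ 1 - β n := by linarith [(hβ n).2]
    refine (hstep n).trans (smul_le_smul_of_nonneg_left (add_le_add ?_ ?_) hβ1)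
    · exact smul_le_smul_of_nonneg_left ih hα0
    · exact smul_le_smul_of_nonneg_left (hmono hy hu ih) hα1

/-- The dampened map `(1 - ε) • f` has a fixpoint below every fixpoint of `f`. -/
theorem exists_dampened_fixpoint {d : ℕ} {X : Set (Fin d → ℝ)} (hX : IsClosed X)
    (hXc : Convex ℝ X) (h0 : (0 : Fin d → ℝ) ∈ X) {f : (Fin d → ℝ) → Fin d → ℝ}
    (hmap : MapsTo f X X) (hmono : MonotoneOn f X) (hne : LipschitzOnWith 1 f X)
    {μ : Fin d → ℝ} (hμX : μ ∈ X) (hμ0 : 0 ≤ μ) (hμ : f μ = μ) {ε : ℝ}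
    (hε : ε ∈ Ioo (0 : ℝ) 1) : ∃ y ∈ X, y ≤ μ ∧ (1 - ε) • f y = y := by
  have hε1 : 0 ≤ 1 - ε := by linarith [hε.2]
  have hmaps : MapsTo (fun x => (1 - ε) • f x) (X ∩ Iic μ) (X ∩ Iic μ) := by
    rintro x ⟨hx, hxμ⟩
    refine ⟨hXc.smul_mem_of_zero_mem h0 (hmap hx) ⟨hε1, by linarith [hε.1]⟩, fun i => ?_⟩
    have h1 : f x i ≤ μ i := by simpa [hμ] using hmono hx hμX hxμ i
    have h2 : 0 ≤ μ i := hμ0 i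
    simp only [Pi.smul_apply, smul_eq_mul]
    nlinarith [hε.1]
  have hcontr : ContractingWith (1 - ε).toNNReal (hmaps.restrict _ _ _) := by
    refine ⟨by simpa using hε.1, LipschitzWith.of_dist_le_mul ?_⟩
    rintro ⟨x, hx⟩ ⟨y, hy⟩
    have h := hne.dist_le_mul x hx.1 y hy.1
    simp only [NNReal.coe_one, one_mul] at h
    simp only [Subtype.dist_eq, MapsTo.val_restrict_apply, dist_smul₀, Real.norm_of_nonneg hε1,
      Real.coe_toNNReal _ hε1]
    exact mul_le_mul_of_nonneg_left h hε1
  obtain ⟨y, hy, hfix, -⟩ := hcontr.exists_fixedPoint' (hX.inter isClosed_Iic).isComplete hmaps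
    ⟨h0, hμ0⟩ (edist_ne_top _ _)
  exact ⟨y, hy.1, hy.2, hfix⟩

/-- The least fixpoint of `f` is a limit of fixpoints of dampened maps `(1 - ε) • f`. -/
theorem exists_dampened_fixpoint_dist_lt {d : ℕ} {X : Set (Fin d → ℝ)} (hX : IsClosed X)
    (hXc : Convex ℝ X) (hpos : ∀ x ∈ X, 0 ≤ x) (h0 : (0 : Fin d → ℝ) ∈ X)
    {f : (Fin d → ℝ) → Fin d → ℝ} (hmap : MapsTo f X X) (hmono : MonotoneOn f X)
    (hne : LipschitzOnWith 1 f X) {μ : Fin d → ℝ} (hμ : IsLeast {x | x ∈ X ∧ f x = x} μ)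
    {δ : ℝ} (hδ : 0 < δ) :
    ∃ ε ∈ Ioo (0 : ℝ) 1, ∃ y ∈ X, y ≤ μ ∧ (1 - ε) • f y = y ∧ dist y μ < δ := by
  have hε (k : ℕ) : (1 : ℝ) / ((k + 1 : ℕ) + 1) ∈ Ioo (0 : ℝ) 1 := by
    refine ⟨by positivity, ?_⟩
    rw [div_lt_one (by positivity)]
    push_cast
    linarith [Nat.cast_nonneg (α := ℝ) k]
  choose y hyX hyμ hy using fun k =>
    exists_dampened_fixpoint hX hXc h0 hmap hmono hne hμ.1.1 (hpos _ hμ.1.1) hμ.1.2 (hε k)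
  have hcomp : IsCompact (X ∩ Icc 0 μ) := isCompact_Icc.inter_left hX
  obtain ⟨z, hz, φ, hφ, hlim⟩ := hcomp.tendsto_subseq
    fun k => ⟨hyX k, hpos _ (hyX k), hyμ k⟩
  have hflim : Tendsto (fun k => f (y (φ k))) atTop (𝓝 (f z)) :=
    (hne.continuousOn z hz.1).tendsto.comp
      (tendsto_nhdsWithin_iff.2 ⟨hlim, Eventually.of_forall fun k => hyX _⟩)
  have hε0 : Tendsto (fun k => (1 : ℝ) - 1 / ((φ k + 1 : ℕ) + 1)) atTop (𝓝 1) := by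
    have := (tendsto_one_div_add_atTop_nhds_zero_nat (𝕜 := ℝ)).comp
      ((tendsto_add_atTop_nat 1).comp hφ.tendsto_atTop)
    simpa using this.const_sub 1
  have hfz : f z = z := by
    refine tendsto_nhds_unique ?_ hlim
    have := hε0.smul hflim
    rw [one_smul] at this
    exact this.congr fun k => hy (φ k)
  obtain rfl : z = μ := le_antisymm hz.2.2 (hμ.2 ⟨hz.1, hfz⟩)
  obtain ⟨k, hk⟩ := (hlim.eventually (Metric.ball_mem_nhds z hδ)).exists
  exact ⟨_, hε (φ k), y (φ k), hyX _, hyμ _, hy _, hk⟩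

/-- A fixpoint of `(1 - ε) • f` is eventually increased by the steps of the dampened iteration. -/
theorem eventually_le_mann_step {d : ℕ} {α β : ℕ → ℝ} (hβ0 : Tendsto β atTop (𝓝 0)) {a : ℝ}
    (ha : a < 1) (hαa : Tendsto α atTop (𝓝 a)) {f : (Fin d → ℝ) → Fin d → ℝ} {ε : ℝ}
    (hε : ε ∈ Ioo (0 : ℝ) 1) {y : Fin d → ℝ} (hy0 : 0 ≤ y) (hy : (1 - ε) • f y = y) :
    ∀ᶠ n in atTop, y ≤ (1 - β n) • (α n • y + (1 - α n) • f y) := by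
  have hε1 : 0 < 1 - ε := by linarith [hε.2]
  have hfy : f y = (1 - ε)⁻¹ • y := by rw [← hy, smul_smul, inv_mul_cancel₀ hε1.ne', one_smul, hy]
  have hlim : Tendsto (fun n => (1 - β n) * (α n + (1 - α n) * (1 - ε)⁻¹)) atTop
      (𝓝 ((1 - 0) * (a + (1 - a) * (1 - ε)⁻¹))) :=
    (hβ0.const_sub 1).mul (hαa.add ((hαa.const_sub 1).mul_const _))
  have hgt : 1 < (1 - 0) * (a + (1 - a) * (1 - ε)⁻¹) := by
    have : 1 < (1 - ε)⁻¹ := (one_lt_inv₀ hε1).2 (by linarith [hε.1])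
    nlinarith
  filter_upwards [hlim.eventually (lt_mem_nhds hgt)] with n hn i
  have h1 : 0 ≤ y i := hy0 i
  rw [hfy]
  simp only [Pi.smul_apply, Pi.add_apply, smul_eq_mul]
  nlinarith [mul_le_mul_of_nonneg_right hn.le h1]

/-- every relaxed Mann-Kleene scheme (`α n, β n ∈ [0,1)`,
`β n → 0`, `Σ β n = ∞`, `α n → a` with `a < 1`) is exact: the dampened Mann
iteration with the constant function sequence `f` converges to the least
fixpoint of `f` from every starting point. -/
theorem relaxedMannKleene_exact
    (α β : ℕ → ℝ) (hα : ∀ n, α n ∈ Set.Ico (0 : ℝ) 1) (hβ : ∀ n, β n ∈ Set.Ico (0 : ℝ) 1)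
    (hβ0 : Tendsto β atTop (nhds 0)) (hβdiv : ¬ Summable β)
    (a : ℝ) (ha : a < 1) (hαa : Tendsto α atTop (nhds a))
    (d : ℕ) (X : Set (Fin d → ℝ)) (hX : IsClosed X) (hXc : Convex ℝ X)
    (hpos : ∀ x ∈ X, ∀ i, 0 ≤ x i) (h0 : (0 : Fin d → ℝ) ∈ X)
    (f : (Fin d → ℝ) → (Fin d → ℝ)) (hmap : Set.MapsTo f X X)
    (hmono : ∀ x ∈ X, ∀ y ∈ X, x ≤ y → f x ≤ f y)
    (hne : LipschitzOnWith 1 f X)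
    (hfix : ∃ x ∈ X, f x = x)
    (μ : Fin d → ℝ) (hμ : IsLeast {x | x ∈ X ∧ f x = x} μ)
    (x0 : Fin d → ℝ) (hx0 : x0 ∈ X) :
    Tendsto (mannSeq α β (fun _ => f) x0) atTop (nhds μ) := by
  have hpos' : ∀ x ∈ X, (0 : Fin d → ℝ) ≤ x := fun x hx i => hpos x hx i
  have hmono' : MonotoneOn f X := fun x hx y hy h => hmono x hx y hy h
  rw [Metric.tendsto_atTop']
  intro δ hδ
  obtain ⟨ε, hε, y, hyX, hyμ, hy, hyd⟩ :=
    exists_dampened_fixpoint_dist_lt hX hXc hpos' h0 hmap hmono' hne hμ (half_pos hδ)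
  obtain ⟨N, hN⟩ := eventually_atTop.1
    (eventually_le_mann_step hβ0 ha hαa hε (hpos' y hyX) hy)
  have hα' : ∀ n, α (n + N) ∈ Ico (0 : ℝ) 1 := fun n => hα _
  have hβ' : ∀ n, β (n + N) ∈ Ico (0 : ℝ) 1 := fun n => hβ _
  have hxN := mannSeq_mem hα hβ hXc h0 hmap hx0 N
  have hprod := (tendsto_prod_one_sub_zero hβ'
    (fun h => hβdiv ((summable_nat_add_iff N).1 h))).mul_const
      (dist (mannSeq α β (fun _ => f) x0 N) y)
  rw [zero_mul] at hprod
  obtain ⟨M, hM⟩ := eventually_atTop.1 (hprod.eventually (gt_mem_nhds (half_pos hδ)))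
  refine ⟨M + N, fun n hn => ?_⟩
  obtain ⟨m, rfl⟩ : ∃ m, n = m + N := ⟨n - N, by omega⟩
  have hmerge := dist_mannSeq_le hα' hβ' hXc h0 hmap hne hxN hyX m
  rw [← mannSeq_add] at hmerge
  have hlow := le_mannSeq_of_le_step hα' hβ' hXc h0 hmap hmono' hyX (fun n => hN _ (by omega)) m
  have hup := mannSeq_le_of_fixed hα' hβ' hXc h0 hmap hmono' hμ.1.1 (hpos' μ hμ.1.1) hμ.1.2
    hyX hyμ m
  set z := mannSeq (fun k => α (k + N)) (fun k => β (k + N)) (fun _ => f) y m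
  have hz : dist z μ ≤ dist y μ := Real.dist_le_of_mem_pi_Icc ⟨hlow, hup⟩ ⟨hyμ, le_rfl⟩
  linarith [dist_triangle (mannSeq α β (fun _ => f) x0 (m + N)) z μ, hM m (by omega)]
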